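/- arXiv:2112.13212 — 9 statements merged into one kernel-verified Lean document; each statement's English description precedes it below -/
import Mathlib

section
/- Let E be a vector space over ℂ, let V₀ ⊆ E be a convex set containing 0, let V₁, B ⊆ E be subsets, and let λ > 0, C > 0. Assume that for every r > 0 one has V₁ ⊆ r^{−λ}·V₀ + (C·r)·B, i.e. every v ∈ V₁ can be written v = r^{−λ}·x + C·r·b with x ∈ V₀ and b ∈ B. Then for every n ∈ ℕ, every ρ > 0 and every linear subspace L ⊆ E with dim L ≤ n such that B ⊆ ρ·V₀ + L, one has V₁ ⊆ ((1+C)·ρ^{λ/(1+λ)})·V₀ + L. (Consequently the n-th Kolmogorov diameter of V₁ with respect to V₀ satisfies d_n(V₁;V₀) ≤ (1+C)·d_n(B;V₀)^{λ/(1+λ)}.) -/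
/-- abstract Kolmogorov-diameter estimate from the Ω̃-type decomposition
`V₁ ⊆ r^{-λ}·V₀ + (C·r)·B` for all `r > 0`. -/
theorem statement0 {E : Type*} [AddCommGroup E] [Module ℂ E]
    (V₀ V₁ B : Set E) (hconv : Convex ℝ V₀) (h0 : (0 : E) ∈ V₀)
    (lam C : ℝ) (hlam : 0 < lam) (hC : 0 < C)
    (hyp : ∀ r : ℝ, 0 < r → ∀ v ∈ V₁, ∃ x ∈ V₀, ∃ b ∈ B,
      v = ((r ^ (-lam) : ℝ) : ℂ) • x + ((C * r : ℝ) : ℂ) • b) :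
    ∀ (n : ℕ) (ρ : ℝ), 0 < ρ → ∀ L : Submodule ℂ E, Module.rank ℂ L ≤ (n : Cardinal) →
      (∀ b ∈ B, ∃ x ∈ V₀, ∃ l ∈ L, b = ((ρ : ℝ) : ℂ) • x + l) →
      ∀ v ∈ V₁, ∃ x ∈ V₀, ∃ l ∈ L,
        v = (((1 + C) * ρ ^ (lam / (1 + lam)) : ℝ) : ℂ) • x + l := by
  intro n ρ hρ L _ hB v hv
  have hlam' : 1 + lam ≠ 0 := by positivity
  have hC' : (1 + C : ℂ) ≠ 0 := by exact_mod_cast (by positivity : (1 + C : ℝ) ≠ 0)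
  obtain ⟨x, hx, b, hb, rfl⟩ := hyp (ρ ^ (-(1 / (1 + lam)))) (by positivity) v hv
  obtain ⟨y, hy, l, hl, rfl⟩ := hB b hb
  have hpow : (ρ ^ (-(1 / (1 + lam)))) ^ (-lam) = ρ ^ (lam / (1 + lam)) := by
    rw [← Real.rpow_mul hρ.le]
    congr 1
    ring
  have hmul : ρ ^ (-(1 / (1 + lam))) * ρ = ρ ^ (lam / (1 + lam)) := by
    rw [← Real.rpow_add_one hρ.ne']
    congr 1
    field_simp
    ring
  refine ⟨(1 / (1 + C)) • x + (C / (1 + C)) • y,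
    hconv hx hy (by positivity) (by positivity) (by field_simp),
    ((C * ρ ^ (-(1 / (1 + lam))) : ℝ) : ℂ) • l, L.smul_mem _ hl, ?_⟩
  rw [hpow, smul_add, smul_smul, ← Complex.ofReal_mul, mul_assoc, hmul,
    ← Complex.coe_smul (1 / (1 + C)) x, ← Complex.coe_smul (C / (1 + C)) y]
  push_cast
  match_scalars <;> field_simp
end

section
/- Let B_d = {z ∈ ℂ^d : ‖z‖ < 1} be the open Euclidean unit ball and let z₀ ∈ B_d. Then B_d has property Ω̃_{z₀}: there exist ε > 0 with the closed ball B̄(z₀,ε) ⊆ B_d, a compact set K₁ ⊆ B_d, and λ > 0, such that for every compact set K ⊆ B_d there is C > 0 with the property that for every r > 0, every holomorphic function f : B_d → ℂ with sup_{w∈K₁}|f(w)| ≤ 1 admits a decomposition f = g + h with g, h holomorphic on B_d, sup_{w∈B̄(z₀,ε)}|g(w)| ≤ C/r and sup_{w∈K}|h(w)| ≤ r^λ. -/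
section HomogeneousExpansion

open Metric Set MeasureTheory
open scoped Topology Nat

variable {E : Type*} [NormedAddCommGroup E] [NormedSpace ℂ E]

/-- A function holomorphic on the unit ball has a locally uniformly bounded derivative. -/
theorem exists_norm_fderiv_le_of_differentiableOn_unitBall [FiniteDimensional ℂ E] {f : E → ℂ}
    (hf : DifferentiableOn ℂ f (ball 0 1)) {r : ℝ} (hr : r < 1) :
    ∃ M : ℝ, ∀ x ∈ ball (0 : E) r, ‖fderiv ℂ f x‖ ≤ M := by
  have : ProperSpace E := FiniteDimensional.proper ℂ E
  obtain ⟨ρ, hrρ, hρ⟩ := exists_between hr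
  have hsub : closedBall (0 : E) ρ ⊆ ball 0 1 := closedBall_subset_ball hρ
  obtain ⟨M, hM⟩ := (isCompact_closedBall (0 : E) ρ).exists_bound_of_continuousOn
    (hf.continuousOn.mono hsub)
  refine ⟨2 * M / (ρ - r), fun x hx ↦ ?_⟩
  have hxr : ‖x‖ < r := by simpa using hx
  have hball : ball x (ρ - r) ⊆ closedBall 0 ρ := by
    intro y hy
    have h1 : ‖y - x‖ < ρ - r := by simpa [dist_eq_norm] using hy
    have h2 : ‖y‖ ≤ ‖y - x‖ + ‖x‖ := by simpa using norm_add_le (y - x) x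
    simp only [mem_closedBall, dist_zero_right]
    linarith
  refine Complex.norm_fderiv_le_div_of_mapsTo_ball (hf.mono (hball.trans hsub)) ?_ (sub_pos.2 hrρ)
  intro y hy
  have h1 := hM y (hball hy)
  have h2 := hM x (hball (mem_ball_self (sub_pos.2 hrρ)))
  simp only [mem_closedBall, dist_eq_norm]
  linarith [norm_sub_le (f y) (f x)]

/-- Integrating a holomorphic function on the unit ball along a family of dilations by factors of
norm at most one gives a holomorphic function. -/
theorem differentiableOn_integral_mul_comp_smul [FiniteDimensional ℂ E] {f : E → ℂ}
    (hf : DifferentiableOn ℂ f (ball 0 1)) {c e : ℝ → ℂ} (hc : Continuous c) (he : Continuous e)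
    (he1 : ∀ θ, ‖e θ‖ ≤ 1) (a b : ℝ) :
    DifferentiableOn ℂ (fun w ↦ ∫ θ in a..b, c θ * f (e θ • w)) (ball 0 1) := by
  intro x₀ hx₀
  have : ProperSpace E := FiniteDimensional.proper ℂ E
  let _ : MeasurableSpace E := borel E
  have : BorelSpace E := ⟨rfl⟩
  obtain ⟨r, hxr, hr⟩ := exists_between (show ‖x₀‖ < 1 by simpa using hx₀)
  obtain ⟨M, hM⟩ := exists_norm_fderiv_le_of_differentiableOn_unitBall hf hr
  have hdil : ∀ {R : ℝ} {x : E}, x ∈ ball (0 : E) R → ∀ θ, e θ • x ∈ ball (0 : E) R := by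
    intro R x hx θ
    have hx' : ‖x‖ < R := by simpa using hx
    have : ‖e θ‖ * ‖x‖ ≤ 1 * ‖x‖ := by gcongr; exact he1 θ
    simp only [mem_ball, dist_zero_right, norm_smul]
    linarith
  have hcont : ∀ x ∈ ball (0 : E) 1, Continuous fun θ ↦ c θ * f (e θ • x) := fun x hx ↦
    hc.mul (hf.continuousOn.comp_continuous (by fun_prop) (hdil hx))
  refine (intervalIntegral.hasFDerivAt_integral_of_dominated_of_fderiv_le (𝕜 := ℂ)
    (s := ball (0 : E) r) (bound := fun θ ↦ ‖c θ‖ * M)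
    (F' := fun x θ ↦ (c θ * e θ) • fderiv ℂ f (e θ • x))
    (isOpen_ball.mem_nhds (by simpa using hxr)) ?_ ?_ ?_ ?_ ?_
    ?_).differentiableAt.differentiableWithinAt
  · filter_upwards [isOpen_ball.mem_nhds hx₀] with x hx
    exact (hcont x hx).aestronglyMeasurable
  · exact (hcont x₀ hx₀).intervalIntegrable a b
  · refine Measurable.aestronglyMeasurable ?_
    have h1 : Measurable fun θ ↦ fderiv ℂ f (e θ • x₀) :=
      (measurable_fderiv ℂ f).comp (he.smul continuous_const).measurable
    exact (hc.mul he).measurable.smul h1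
  · refine .of_forall fun θ _ x hx ↦ ?_
    have h1 := hM _ (hdil hx θ)
    rw [norm_smul, norm_mul]
    have h2 : ‖c θ‖ * ‖e θ‖ ≤ ‖c θ‖ * 1 := by gcongr; exact he1 θ
    calc ‖c θ‖ * ‖e θ‖ * ‖fderiv ℂ f (e θ • x)‖ ≤ ‖c θ‖ * 1 * M := by gcongr
      _ = ‖c θ‖ * M := by ring
  · exact (hc.norm.mul continuous_const).intervalIntegrable a b
  · refine .of_forall fun θ _ x hx ↦ ?_
    have hx1 : e θ • x ∈ ball (0 : E) 1 := hdil (ball_subset_ball hr.le hx) θ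
    have h1 : HasFDerivAt f (fderiv ℂ f (e θ • x)) (e θ • x) :=
      (hf.differentiableAt (isOpen_ball.mem_nhds hx1)).hasFDerivAt
    have h2 : HasFDerivAt (fun x : E ↦ e θ • x) (e θ • ContinuousLinearMap.id ℂ E) x :=
      (hasFDerivAt_id x).const_smul (e θ)
    have h3 := (h1.comp x h2).const_mul (c θ)
    refine h3.congr_fderiv ?_
    ext v
    simp [mul_assoc]

/-- The degree `k` term, at `w`, of the expansion of `f` at the origin into homogeneous
polynomials: the `k`-th Taylor coefficient of `ζ ↦ f (ζ • w)`. -/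
noncomputable def homogeneousPart (f : E → ℂ) (k : ℕ) (w : E) : ℂ :=
  (k ! : ℂ)⁻¹ * iteratedDeriv k (fun ζ : ℂ ↦ f (ζ • w)) 0

/-- The slice `ζ ↦ f (ζ • w)` is holomorphic as long as `ζ • w` stays in the unit ball. -/
theorem differentiableOn_comp_smul_of_unitBall {f : E → ℂ} (hf : DifferentiableOn ℂ f (ball 0 1))
    {w : E} {R : ℝ} (hR : R * ‖w‖ < 1) :
    DifferentiableOn ℂ (fun ζ : ℂ ↦ f (ζ • w)) (closedBall 0 R) := by
  refine hf.comp (by fun_prop) fun ζ hζ ↦ ?_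
  have h1 : ‖ζ‖ ≤ R := by simpa using hζ
  simp only [mem_ball, dist_zero_right, norm_smul]
  exact lt_of_le_of_lt (by gcongr) hR

/-- Cauchy's estimate for the homogeneous parts. -/
theorem norm_homogeneousPart_le {f : E → ℂ} (hf : DifferentiableOn ℂ f (ball 0 1)) {t : ℝ}
    (ht : t < 1) (hft : ∀ w ∈ closedBall (0 : E) t, ‖f w‖ ≤ 1) {w : E} {R : ℝ} (hR0 : 0 < R)
    (hR : R * ‖w‖ ≤ t) (k : ℕ) : ‖homogeneousPart f k w‖ ≤ R⁻¹ ^ k := by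
  have hd := differentiableOn_comp_smul_of_unitBall hf (hR.trans_lt ht)
  have h := Complex.norm_iteratedDeriv_le_of_forall_mem_sphere_norm_le (C := 1) k hR0
    (hd.mono closure_ball_subset_closedBall).diffContOnCl (fun ζ hζ ↦ hft _ (by
      have h1 : ‖ζ‖ = R := by simpa using hζ
      simpa [norm_smul, h1] using hR))
  rw [homogeneousPart, norm_mul, norm_inv, Complex.norm_natCast]
  calc (k ! : ℝ)⁻¹ * ‖iteratedDeriv k (fun ζ : ℂ ↦ f (ζ • w)) 0‖
      ≤ (k ! : ℝ)⁻¹ * (k ! * 1 / R ^ k) := by gcongr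
    _ = R⁻¹ ^ k := by
      have : (k ! : ℝ) ≠ 0 := by positivity
      rw [inv_pow]
      field_simp

theorem hasSum_homogeneousPart {f : E → ℂ} (hf : DifferentiableOn ℂ f (ball 0 1)) {w : E}
    (hw : w ∈ ball (0 : E) 1) : HasSum (fun k ↦ homogeneousPart f k w) (f w) := by
  have hw' : ‖w‖ < 1 := by simpa using hw
  have hR : 2 / (1 + ‖w‖) * ‖w‖ < 1 := by
    rw [div_mul_eq_mul_div, div_lt_one (by positivity)]
    linarith
  have hR1 : 1 < 2 / (1 + ‖w‖) := by
    rw [lt_div_iff₀ (by positivity)]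
    linarith
  have h := Complex.hasSum_taylorSeries_on_ball (z := 1)
    ((differentiableOn_comp_smul_of_unitBall hf hR).mono ball_subset_closedBall)
    (by simpa using hR1)
  simpa [homogeneousPart] using h

theorem differentiableOn_homogeneousPart [FiniteDimensional ℂ E] {f : E → ℂ}
    (hf : DifferentiableOn ℂ f (ball 0 1)) (k : ℕ) :
    DifferentiableOn ℂ (homogeneousPart f k) (ball 0 1) := by
  have hne : ∀ θ, circleMap 0 1 θ ≠ 0 := fun θ ↦ circleMap_ne_center one_ne_zero
  have hI := (differentiableOn_integral_mul_comp_smul hf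
    (c := fun θ ↦ deriv (circleMap 0 1) θ * (1 / circleMap 0 1 θ ^ (k + 1))) (e := circleMap 0 1)
    (by
      simp only [deriv_circleMap]
      exact (by fun_prop : Continuous fun θ ↦ circleMap 0 1 θ * Complex.I).mul
        (continuous_const.div (by fun_prop) fun θ ↦ pow_ne_zero _ (hne θ)))
    (continuous_circleMap 0 1) (by simp) 0 (2 * Real.pi)).const_mul
    (2 * Real.pi * Complex.I : ℂ)⁻¹
  refine hI.congr fun w hw ↦ ?_
  have hw' : 1 * ‖w‖ < 1 := by simpa using hw
  have h := ((differentiableOn_comp_smul_of_unitBall hf hw').mono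
    closure_ball_subset_closedBall).diffContOnCl.circleIntegral_one_div_sub_center_pow_smul
    one_pos k
  simp only [circleIntegral, smul_eq_mul, sub_zero, ← mul_assoc] at h
  have hpi : (2 * Real.pi * Complex.I : ℂ) ≠ 0 := Complex.two_pi_I_ne_zero
  simp only [h, homogeneousPart]
  field_simp

/-- If `A ≤ r` and `0 < t < 1`, then some power of `t` is comparable to `A / r`. -/
theorem exists_pow_threshold {t A r : ℝ} (ht0 : 0 < t) (ht1 : t < 1) (hA : 0 < A) (hr : A ≤ r) :
    ∃ N : ℕ, A * t⁻¹ ^ N ≤ r ∧ t ^ N ≤ A / (t * r) := by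
  have hr0 : 0 < r := hA.trans_le hr
  obtain ⟨N, h1, h2⟩ := exists_nat_pow_near ((one_le_div hA).2 hr) ((one_lt_inv₀ ht0).2 ht1)
  refine ⟨N, by rwa [mul_comm, ← le_div_iff₀ hA], ?_⟩
  rw [inv_pow, pow_succ, div_lt_iff₀ hA, inv_mul_eq_div, lt_div_iff₀ (by positivity)] at h2
  rw [le_div_iff₀ (by positivity)]
  linarith

/-- Truncating the homogeneous expansion of `f`: the partial sums are controlled on the whole ball
and the remainders on a smaller ball. -/
theorem norm_truncation_le {f : E → ℂ} (hf : DifferentiableOn ℂ f (ball 0 1)) {t : ℝ}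
    (ht0 : 0 < t) (ht1 : t < 1) (hft : ∀ w ∈ closedBall (0 : E) t, ‖f w‖ ≤ 1) (N : ℕ) :
    (∀ w ∈ ball (0 : E) 1,
      ‖∑ k ∈ Finset.range N, homogeneousPart f k w‖ ≤ (1 - t)⁻¹ * t⁻¹ ^ N) ∧
    ∀ w ∈ closedBall (0 : E) (t ^ 2),
      ‖f w - ∑ k ∈ Finset.range N, homogeneousPart f k w‖ ≤ (1 - t)⁻¹ * t ^ N := by
  have ht' : 0 < 1 - t := sub_pos.2 ht1
  refine ⟨fun w hw ↦ ?_, fun w hw ↦ ?_⟩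
  · have hw' : ‖w‖ < 1 := by simpa using hw
    calc ‖∑ k ∈ Finset.range N, homogeneousPart f k w‖
        ≤ ∑ k ∈ Finset.range N, t⁻¹ ^ k := norm_sum_le_of_le _ fun k _ ↦
          norm_homogeneousPart_le hf ht1 hft ht0 (by nlinarith) k
      _ = t * (1 - t)⁻¹ * (t⁻¹ ^ N - 1) := by
          have h1 : t⁻¹ ≠ 1 := by simpa using ht1.ne
          rw [geom_sum_eq h1]
          have h2 : t⁻¹ - 1 = (1 - t) / t := by field_simp
          rw [h2]
          field_simp
      _ ≤ 1 * (1 - t)⁻¹ * t⁻¹ ^ N := by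
          have : 1 ≤ t⁻¹ ^ N := one_le_pow₀ ((one_le_inv₀ ht0).2 ht1.le)
          gcongr
          linarith
      _ = (1 - t)⁻¹ * t⁻¹ ^ N := by ring
  · have hw' : ‖w‖ ≤ t ^ 2 := by simpa using hw
    have hw1 : w ∈ ball (0 : E) 1 := by
      simp only [mem_ball, dist_zero_right]
      nlinarith
    have hb (k : ℕ) : ‖homogeneousPart f k w‖ ≤ t ^ k := by
      have := norm_homogeneousPart_le hf ht1 hft (w := w) (inv_pos.2 ht0)
        (by rw [inv_mul_le_iff₀ ht0]; nlinarith) k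
      simpa using this
    have hs := (hasSum_nat_add_iff' N).2 (hasSum_homogeneousPart hf hw1)
    have hg : HasSum (fun k ↦ t ^ (k + N)) ((1 - t)⁻¹ * t ^ N) := by
      simpa only [pow_add] using (hasSum_geometric_of_lt_one ht0.le ht1).mul_right (t ^ N)
    rw [← hs.tsum_eq]
    exact tsum_of_norm_bounded hg fun k ↦ hb (k + N)

end HomogeneousExpansion


/-- the open unit ball of ℂ^d has property Ω̃ at each of its points. -/
theorem statement1 (d : ℕ) (z₀ : EuclideanSpace ℂ (Fin d))
    (hz₀ : z₀ ∈ Metric.ball (0 : EuclideanSpace ℂ (Fin d)) 1) :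
    ∃ ε > (0 : ℝ), Metric.closedBall z₀ ε ⊆ Metric.ball (0 : EuclideanSpace ℂ (Fin d)) 1 ∧
    ∃ K₁ : Set (EuclideanSpace ℂ (Fin d)), IsCompact K₁ ∧
      K₁ ⊆ Metric.ball (0 : EuclideanSpace ℂ (Fin d)) 1 ∧
    ∃ lam > (0 : ℝ), ∀ K : Set (EuclideanSpace ℂ (Fin d)), IsCompact K →
      K ⊆ Metric.ball (0 : EuclideanSpace ℂ (Fin d)) 1 →
      ∃ C > (0 : ℝ), ∀ r > (0 : ℝ), ∀ f : EuclideanSpace ℂ (Fin d) → ℂ,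
        DifferentiableOn ℂ f (Metric.ball (0 : EuclideanSpace ℂ (Fin d)) 1) →
        (∀ w ∈ K₁, ‖f w‖ ≤ 1) →
        ∃ g h : EuclideanSpace ℂ (Fin d) → ℂ,
          DifferentiableOn ℂ g (Metric.ball (0 : EuclideanSpace ℂ (Fin d)) 1) ∧
          DifferentiableOn ℂ h (Metric.ball (0 : EuclideanSpace ℂ (Fin d)) 1) ∧
          (∀ w ∈ Metric.ball (0 : EuclideanSpace ℂ (Fin d)) 1, f w = g w + h w) ∧
          (∀ w ∈ Metric.closedBall z₀ ε, ‖g w‖ ≤ C / r) ∧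
          (∀ w ∈ K, ‖h w‖ ≤ r ^ lam) := by
  have hz : ‖z₀‖ < 1 := by simpa using hz₀
  obtain ⟨t, ht0, ht1, hzt⟩ : ∃ t : ℝ, 0 < t ∧ t < 1 ∧ ‖z₀‖ < t ^ 2 := by
    obtain ⟨s, hs, hs1⟩ := exists_between hz
    have hs0 : 0 < s := (norm_nonneg _).trans_lt hs
    exact ⟨√s, Real.sqrt_pos.2 hs0, by rw [Real.sqrt_lt' one_pos]; simpa using hs1,
      by rwa [Real.sq_sqrt hs0.le]⟩
  have hsub : Metric.closedBall z₀ (t ^ 2 - ‖z₀‖) ⊆ Metric.closedBall 0 (t ^ 2) :=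
    Metric.closedBall_subset_closedBall' (by simp)
  have htt : t ^ 2 ≤ t := by nlinarith
  have ht' : 0 < (1 - t)⁻¹ := inv_pos.2 (sub_pos.2 ht1)
  refine ⟨t ^ 2 - ‖z₀‖, sub_pos.2 hzt,
    hsub.trans (Metric.closedBall_subset_ball (htt.trans_lt ht1)), Metric.closedBall 0 t,
    isCompact_closedBall _ _, Metric.closedBall_subset_ball ht1, 1, one_pos, fun K _ hK ↦
    ⟨max (1 - t)⁻¹ ((1 - t)⁻¹ * ((1 - t)⁻¹ / t)), lt_max_of_lt_left ht',
      fun r hr f hf hft ↦ ?_⟩⟩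
  rcases lt_or_ge r (1 - t)⁻¹ with hrA | hrA
  · refine ⟨f, 0, hf, differentiableOn_const 0, by simp, fun w hw ↦ ?_,
      fun w _ ↦ by simpa using hr.le⟩
    refine (hft w (Metric.closedBall_subset_closedBall htt (hsub hw))).trans ?_
    rw [one_le_div hr]
    exact hrA.le.trans (le_max_left _ _)
  · obtain ⟨N, hN, hN'⟩ := exists_pow_threshold ht0 ht1 ht' hrA
    obtain ⟨h1, h2⟩ := norm_truncation_le hf ht0 ht1 hft N
    have hh : DifferentiableOn ℂ (fun w ↦ ∑ k ∈ Finset.range N, homogeneousPart f k w)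
        (Metric.ball 0 1) := .fun_sum fun k _ ↦ differentiableOn_homogeneousPart hf k
    refine ⟨_, _, hf.sub hh, hh, fun w _ ↦ by simp, fun w hw ↦ ?_, fun w hw ↦ ?_⟩
    · calc _ ≤ (1 - t)⁻¹ * t ^ N := h2 w (hsub hw)
        _ ≤ (1 - t)⁻¹ * ((1 - t)⁻¹ / (t * r)) := by gcongr
        _ = (1 - t)⁻¹ * ((1 - t)⁻¹ / t) / r := by rw [mul_div_assoc, div_div]
        _ ≤ _ := by gcongr; exact le_max_right _ _
    · rw [Real.rpow_one]
      exact (h1 w (hK hw)).trans hN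
end

section
/- Let d ≥ 1. The space ℂ^d does not have property Ω̃_0. Precisely: for every ε > 0, every compact set K₁ ⊆ ℂ^d and every λ > 0, there exists a compact set K ⊆ ℂ^d such that for every C > 0 there exist r > 0 and an entire function f : ℂ^d → ℂ with sup_{w∈K₁}|f(w)| ≤ 1 which admits NO decomposition f = g + h with g, h entire, sup_{w∈B̄(0,ε)}|g(w)| ≤ C/r and sup_{w∈K}|h(w)| ≤ r^λ. -/
/-- Cauchy estimate along a coordinate axis of `ℂ^d`. -/
theorem norm_iteratedDeriv_single_le {d : ℕ} (i : Fin d) {g : EuclideanSpace ℂ (Fin d) → ℂ}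
    (hg : Differentiable ℂ g) {R M : ℝ} (hR : 0 < R)
    (hM : ∀ w ∈ Metric.closedBall (0 : EuclideanSpace ℂ (Fin d)) R, ‖g w‖ ≤ M) (n : ℕ) :
    ‖iteratedDeriv n (fun t : ℂ => g (t • EuclideanSpace.single i 1)) 0‖
      ≤ n.factorial * M / R ^ n := by
  have hd : Differentiable ℂ (fun t : ℂ => g (t • EuclideanSpace.single i 1)) :=
    hg.comp (by fun_prop)
  refine Complex.norm_iteratedDeriv_le_of_forall_mem_sphere_norm_le n hR hd.diffContOnCl ?_
  intro t ht
  apply hM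
  simpa [norm_smul] using (mem_sphere_zero_iff_norm.mp ht).le

theorem iteratedDeriv_mul_pow_self (n : ℕ) (a : ℂ) :
    iteratedDeriv n (fun t : ℂ => (t * a) ^ n) 0 = n.factorial * a ^ n := by
  have h : (fun t : ℂ => (t * a) ^ n) = fun t => a ^ n * t ^ n := by
    ext t; ring
  rw [h, iteratedDeriv_const_mul_field]
  simp [Nat.descFactorial_self, mul_comm]

/-- ℂ^d (d ≥ 1) does not have property Ω̃ at the origin. -/
theorem statement2 (d : ℕ) (hd : 1 ≤ d) :
    ∀ ε > (0 : ℝ), ∀ K₁ : Set (EuclideanSpace ℂ (Fin d)), IsCompact K₁ →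
    ∀ lam > (0 : ℝ),
    ∃ K : Set (EuclideanSpace ℂ (Fin d)), IsCompact K ∧
      ∀ C > (0 : ℝ), ∃ r > (0 : ℝ), ∃ f : EuclideanSpace ℂ (Fin d) → ℂ,
        Differentiable ℂ f ∧ (∀ w ∈ K₁, ‖f w‖ ≤ 1) ∧
        ¬ ∃ g h : EuclideanSpace ℂ (Fin d) → ℂ,
            Differentiable ℂ g ∧ Differentiable ℂ h ∧
            (∀ w, f w = g w + h w) ∧
            (∀ w ∈ Metric.closedBall (0 : EuclideanSpace ℂ (Fin d)) ε, ‖g w‖ ≤ C / r) ∧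
            (∀ w ∈ K, ‖h w‖ ≤ r ^ lam) := by
  intro ε hε K₁ hK₁ lam hlam
  obtain ⟨R₁, hR₁, hbd⟩ := hK₁.isBounded.exists_pos_norm_le
  have i : Fin d := ⟨0, hd⟩
  set s : ℝ := 2 * R₁ / ε with hs
  have hs0 : 0 < s := by positivity
  set R : ℝ := 2 * R₁ * s ^ lam with hRdef
  have hsl : 0 < s ^ lam := Real.rpow_pos_of_pos hs0 _
  have hR : 0 < R := by positivity
  refine ⟨Metric.closedBall 0 R, isCompact_closedBall _ _, fun C hC => ?_⟩
  obtain ⟨n, hn⟩ := pow_unbounded_of_one_lt (C + 1) (one_lt_two : (1 : ℝ) < 2)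
  refine ⟨s ^ n, by positivity, fun w => (w i * (R₁ : ℂ)⁻¹) ^ n, by fun_prop, ?_, ?_⟩
  · intro w hw
    have h1 : ‖w i‖ ≤ R₁ := (PiLp.norm_apply_le w i).trans (hbd w hw)
    rw [norm_pow]
    refine pow_le_one₀ (norm_nonneg _) ?_
    rw [norm_mul, norm_inv, Complex.norm_real, Real.norm_of_nonneg hR₁.le,
      mul_inv_le_iff₀ hR₁]
    simpa using h1
  · rintro ⟨g, h, hg, hh, hfgh, hgb, hhb⟩
    have e1 := norm_iteratedDeriv_single_le i hg hε hgb n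
    have e2 := norm_iteratedDeriv_single_le i hh hR hhb n
    have hadd : iteratedDeriv n (fun t : ℂ => (t * (R₁ : ℂ)⁻¹) ^ n) 0 =
        iteratedDeriv n (fun t : ℂ => g (t • EuclideanSpace.single i 1)) 0 +
        iteratedDeriv n (fun t : ℂ => h (t • EuclideanSpace.single i 1)) 0 := by
      rw [← iteratedDeriv_fun_add]
      · congr 1
        ext t
        have ht : (t • EuclideanSpace.single i (1 : ℂ)) i = t := by
          rw [PiLp.smul_apply]; simp
        exact (congrArg (fun z => (z * (R₁ : ℂ)⁻¹) ^ n) ht.symm).trans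
          (hfgh (t • EuclideanSpace.single i (1 : ℂ)))
      · exact (hg.comp (by fun_prop : Differentiable ℂ
          fun t : ℂ => t • EuclideanSpace.single i (1 : ℂ))).contDiff.contDiffAt
      · exact (hh.comp (by fun_prop : Differentiable ℂ
          fun t : ℂ => t • EuclideanSpace.single i (1 : ℂ))).contDiff.contDiffAt
    have key := norm_add_le_of_le e1 e2
    rw [← hadd, iteratedDeriv_mul_pow_self, norm_mul, norm_pow, norm_inv, Complex.norm_real,
      Real.norm_of_nonneg hR₁.le, Complex.norm_natCast, ← Real.rpow_pow_comm hs0.le] at key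
    have hεs : s * ε = 2 * R₁ := by rw [hs]; field_simp
    have g1 : C / s ^ n / ε ^ n = C / (2 ^ n * R₁ ^ n) := by
      rw [div_div, ← mul_pow, hεs, mul_pow]
    have g2 : (s ^ lam) ^ n / R ^ n = 1 / (2 ^ n * R₁ ^ n) := by
      rw [hRdef, mul_pow, mul_pow]
      field_simp
    rw [mul_div_assoc, mul_div_assoc, g1, g2, ← mul_add, ← add_div] at key
    have hfac : (0 : ℝ) < n.factorial := by exact_mod_cast n.factorial_pos
    have key' := le_of_mul_le_mul_left key hfac
    rw [inv_pow, le_div_iff₀ (by positivity), mul_comm, mul_assoc,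
      mul_inv_cancel₀ (by positivity), mul_one] at key'
    exact absurd hn key'.not_gt
end

section
/- Let M = Δ×ℂ = {(z,w) ∈ ℂ² : |z| < 1}. Then M does not have property Ω̃_{(0,0)}. Precisely: for every ε ∈ (0,1), every compact set K₁ ⊆ M and every λ > 0, there exists a compact set K ⊆ M such that for every C > 0 there exist r > 0 and a holomorphic function f : M → ℂ with sup_{ζ∈K₁}|f(ζ)| ≤ 1 which admits NO decomposition f = g + h with g, h holomorphic on M, sup_{ζ∈B̄((0,0),ε)}|g(ζ)| ≤ C/r and sup_{ζ∈K}|h(ζ)| ≤ r^λ. -/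
/-- The manifold `M = Δ × ℂ ⊆ ℂ²`. -/
def discTimesPlane : Set (ℂ × ℂ) := {p : ℂ × ℂ | ‖p.1‖ < 1}

/-- If a monomial `c * w ^ n` is a sum of two entire functions, then the Cauchy estimates for the
summands, on circles of possibly different radii, bound its coefficient. -/
theorem norm_coeff_le_of_monomial_eq_add {g h : ℂ → ℂ} {c : ℂ} {n : ℕ} {A B ρ R : ℝ}
    (hρ : 0 < ρ) (hR : 0 < R) (hg : Differentiable ℂ g) (hh : Differentiable ℂ h)
    (hgh : ∀ w, c * w ^ n = g w + h w)
    (hA : ∀ w ∈ Metric.sphere (0 : ℂ) ρ, ‖g w‖ ≤ A)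
    (hB : ∀ w ∈ Metric.sphere (0 : ℂ) R, ‖h w‖ ≤ B) :
    ‖c‖ ≤ A / ρ ^ n + B / R ^ n := by
  have hg' := Complex.norm_iteratedDeriv_le_of_forall_mem_sphere_norm_le n hρ hg.diffContOnCl hA
  have hh' := Complex.norm_iteratedDeriv_le_of_forall_mem_sphere_norm_le n hR hh.diffContOnCl hB
  have hsum : iteratedDeriv n (fun w : ℂ => c * w ^ n) 0
      = iteratedDeriv n g 0 + iteratedDeriv n h 0 := by
    rw [funext hgh]
    exact iteratedDeriv_fun_add hg.contDiff.contDiffAt hh.contDiff.contDiffAt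
  have hmono : iteratedDeriv n (fun w : ℂ => c * w ^ n) 0 = c * n.factorial := by
    rw [iteratedDeriv_const_mul_field, iteratedDeriv_fun_pow_zero, if_pos rfl]
  have hfac : (0 : ℝ) < n.factorial := by exact_mod_cast n.factorial_pos
  have hle : ‖c‖ * n.factorial ≤ (A / ρ ^ n + B / R ^ n) * n.factorial := by
    calc ‖c‖ * n.factorial = ‖iteratedDeriv n g 0 + iteratedDeriv n h 0‖ := by
          rw [← hsum, hmono, norm_mul, Complex.norm_natCast]
      _ ≤ n.factorial * A / ρ ^ n + n.factorial * B / R ^ n := norm_add_le_of_le hg' hh'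
      _ = _ := by ring
  exact le_of_mul_le_mul_right hle hfac

/-- A holomorphic function on `Δ × ℂ` restricts to an entire function on `{0} × ℂ`. -/
theorem differentiable_fiber_zero {g : ℂ × ℂ → ℂ} (hg : DifferentiableOn ℂ g discTimesPlane) :
    Differentiable ℂ fun w : ℂ => g (0, w) := by
  rw [← differentiableOn_univ]
  exact hg.comp (by fun_prop) fun w _ => by simp [discTimesPlane]

/-- `Δ × ℂ` does not have property Ω̃ at the origin `(0,0)`. -/
theorem statement3 :
    ∀ ε : ℝ, 0 < ε → ε < 1 →
    ∀ K₁ : Set (ℂ × ℂ), IsCompact K₁ → K₁ ⊆ discTimesPlane →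
    ∀ lam > (0 : ℝ),
    ∃ K : Set (ℂ × ℂ), IsCompact K ∧ K ⊆ discTimesPlane ∧
      ∀ C > (0 : ℝ), ∃ r > (0 : ℝ), ∃ f : ℂ × ℂ → ℂ,
        DifferentiableOn ℂ f discTimesPlane ∧ (∀ ζ ∈ K₁, ‖f ζ‖ ≤ 1) ∧
        ¬ ∃ g h : ℂ × ℂ → ℂ,
            DifferentiableOn ℂ g discTimesPlane ∧ DifferentiableOn ℂ h discTimesPlane ∧
            (∀ ζ ∈ discTimesPlane, f ζ = g ζ + h ζ) ∧
            (∀ ζ ∈ Metric.closedBall ((0, 0) : ℂ × ℂ) ε, ‖g ζ‖ ≤ C / r) ∧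
            (∀ ζ ∈ K, ‖h ζ‖ ≤ r ^ lam) := by
  intro ε hε _ K₁ hK₁ _ lam _
  obtain ⟨W, hW, hK₁W⟩ := hK₁.isBounded.exists_pos_norm_le
  have hWε : 0 < W / ε := by positivity
  set R : ℝ := 2 * (W * (W / ε) ^ lam) with hR_def
  have hR : 0 < R := by positivity
  refine ⟨{0} ×ˢ Metric.closedBall 0 R, isCompact_singleton.prod (isCompact_closedBall 0 R), ?_, ?_⟩
  · rintro ⟨z, w⟩ ⟨hz, -⟩
    simp_all [discTimesPlane]
  intro C hC
  obtain ⟨n, hn⟩ := pow_unbounded_of_one_lt (2 * (4 * C) ^ lam) one_lt_two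
  have hr : 0 < 4 * C * (W / ε) ^ n := by positivity
  refine ⟨4 * C * (W / ε) ^ n, hr, fun ζ => (1 / (W : ℂ) ^ n) * ζ.2 ^ n, by fun_prop, ?_, ?_⟩
  · intro ζ hζ
    rw [norm_mul, norm_div, norm_one, norm_pow, norm_pow, Complex.norm_of_nonneg hW.le,
      one_div_mul_eq_div, ← div_pow]
    exact pow_le_one₀ (by positivity) ((div_le_one hW).2 ((norm_snd_le ζ).trans (hK₁W ζ hζ)))
  rintro ⟨g, h, hg, hh, hgh, hgε, hhK⟩
  have key := norm_coeff_le_of_monomial_eq_add hε hR (differentiable_fiber_zero hg)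
    (differentiable_fiber_zero hh) (fun w => hgh (0, w) (by simp [discTimesPlane]))
    (fun w hw => hgε (0, w) (by
      simpa [Prod.norm_def, hε.le] using (mem_sphere_zero_iff_norm.1 hw).le))
    (fun w hw => hhK (0, w) ⟨rfl, Metric.sphere_subset_closedBall hw⟩)
  rw [norm_div, norm_one, norm_pow, Complex.norm_of_nonneg hW.le] at key
  have hfirst : C / (4 * C * (W / ε) ^ n) / ε ^ n = (1 / W ^ n) * (1 / 4) := by
    rw [div_pow]
    field_simp
  have hsecond : (4 * C * (W / ε) ^ n) ^ lam / R ^ n = (1 / W ^ n) * ((4 * C) ^ lam / 2 ^ n) := by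
    have hpos : 0 < (W / ε) ^ lam := by positivity
    rw [Real.mul_rpow (by positivity) (by positivity), ← Real.rpow_pow_comm hWε.le, hR_def,
      mul_pow, mul_pow]
    field_simp
  have hsmall : (4 * C) ^ lam / 2 ^ n < 1 / 2 := by
    rw [div_lt_iff₀ (by positivity)]
    linarith
  have hWn : 0 < 1 / W ^ n := by positivity
  rw [hfirst, hsecond, ← mul_add] at key
  nlinarith
end

section
/- Let Ω = {z ∈ ℂ : 0 < |z| < 1} be the punctured open unit disc. Then Ω has property Ω̃_ζ for every ζ ∈ Ω: there exist ε > 0 with the closed disc B̄(ζ,ε) ⊆ Ω, a compact set K₁ ⊆ Ω and λ > 0, such that for every compact set K ⊆ Ω there is C > 0 with the property that for every r > 0, every holomorphic function f : Ω → ℂ with sup_{w∈K₁}|f(w)| ≤ 1 admits a decomposition f = g + h with g, h holomorphic on Ω, sup_{w∈B̄(ζ,ε)}|g(w)| ≤ C/r and sup_{w∈K}|h(w)| ≤ r^λ. -/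
/-- The punctured open unit disc in ℂ. -/
def puncturedDisc : Set ℂ := {z : ℂ | 0 < ‖z‖ ∧ ‖z‖ < 1}

/-- The automorphism `w ↦ (w + a) / (1 + conj a * w)` of the unit disc. -/
noncomputable def discAut (a w : ℂ) : ℂ := (w + a) / (1 + (starRingEnd ℂ) a * w)

theorem norm_add_lt_norm_one_add_conj_mul {a w : ℂ} (ha : ‖a‖ < 1) (hw : ‖w‖ < 1) :
    ‖w + a‖ < ‖1 + (starRingEnd ℂ) a * w‖ := by
  have ha2 : ‖a‖ ^ 2 < 1 := by nlinarith [norm_nonneg a]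
  have hw2 : ‖w‖ ^ 2 < 1 := by nlinarith [norm_nonneg w]
  refine lt_of_pow_lt_pow_left₀ 2 (norm_nonneg _) ?_
  simp only [← Complex.normSq_eq_norm_sq, Complex.normSq_apply, Complex.add_re, Complex.add_im,
    Complex.mul_re, Complex.mul_im, Complex.conj_re, Complex.conj_im, Complex.one_re,
    Complex.one_im] at *
  nlinarith [mul_pos (sub_pos.2 ha2) (sub_pos.2 hw2)]

theorem one_add_conj_mul_ne_zero {a w : ℂ} (ha : ‖a‖ < 1) (hw : ‖w‖ < 1) :
    1 + (starRingEnd ℂ) a * w ≠ 0 :=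
  norm_pos_iff.1 ((norm_nonneg _).trans_lt (norm_add_lt_norm_one_add_conj_mul ha hw))

theorem norm_discAut_lt_one {a w : ℂ} (ha : ‖a‖ < 1) (hw : ‖w‖ < 1) : ‖discAut a w‖ < 1 := by
  rw [discAut, norm_div, div_lt_one (norm_pos_iff.2 (one_add_conj_mul_ne_zero ha hw))]
  exact norm_add_lt_norm_one_add_conj_mul ha hw

theorem differentiableAt_discAut {a w : ℂ} (ha : ‖a‖ < 1) (hw : ‖w‖ < 1) :
    DifferentiableAt ℂ (discAut a) w := by
  unfold discAut
  exact DifferentiableAt.fun_div (by fun_prop) (by fun_prop) (one_add_conj_mul_ne_zero ha hw)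

theorem discAut_discAut_neg {a w : ℂ} (ha : ‖a‖ < 1) (hw : ‖w‖ < 1) :
    discAut a (discAut (-a) w) = w := by
  have h1 := one_add_conj_mul_ne_zero (a := -a) (by simpa using ha) hw
  have h2 := one_add_conj_mul_ne_zero ha
    (norm_discAut_lt_one (a := -a) (by simpa using ha) hw)
  unfold discAut at *
  rw [div_eq_iff h2]
  simp only [map_neg, neg_mul, ← sub_eq_add_neg] at *
  generalize (starRingEnd ℂ) a = b at *
  linear_combination div_mul_cancel₀ (w - a) h1

theorem discAut_mem_puncturedDisc {a w : ℂ} (ha : ‖a‖ < 1) (hw : ‖w‖ < ‖a‖) :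
    discAut a w ∈ puncturedDisc := by
  refine ⟨norm_pos_iff.2 (div_ne_zero (fun h : w + a = 0 => ?_)
    (one_add_conj_mul_ne_zero ha (hw.trans ha))), norm_discAut_lt_one ha (hw.trans ha)⟩
  rw [eq_neg_of_add_eq_zero_left h, norm_neg] at hw
  exact lt_irrefl _ hw

theorem isOpen_puncturedDisc : IsOpen puncturedDisc :=
  (isOpen_lt continuous_const continuous_norm).inter (isOpen_lt continuous_norm continuous_const)

/-- The Taylor polynomials of a function bounded by `1` on a disc, with explicit bounds for the
coefficients and for the remainder on the disc of half the radius. -/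
theorem exists_taylor_coeff_bound {F : ℂ → ℂ} {ρ : ℝ} (hρ : 0 < ρ)
    (hF : DifferentiableOn ℂ F (Metric.closedBall 0 ρ))
    (hb : ∀ w ∈ Metric.closedBall (0 : ℂ) ρ, ‖F w‖ ≤ 1) :
    ∃ c : ℕ → ℂ, (∀ n, ‖c n‖ ≤ ρ⁻¹ ^ n) ∧ ∀ N : ℕ, ∀ w : ℂ, ‖w‖ ≤ ρ / 2 →
      ‖F w - ∑ n ∈ Finset.range N, c n * w ^ n‖ ≤ 2 * (1 / 2) ^ N := by
  lift ρ to NNReal using hρ.le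
  have hs := hF.hasFPowerSeriesOnBall (by exact_mod_cast hρ)
  set p := cauchyPowerSeries F 0 (ρ : ℝ) with hp
  have hc : ∀ n, ‖p.coeff n‖ ≤ (ρ : ℝ)⁻¹ ^ n := by
    intro n
    rw [← FormalMultilinearSeries.norm_apply_eq_norm_coef]
    refine (norm_cauchyPowerSeries_le F 0 ρ n).trans ?_
    rw [abs_of_pos hρ]
    refine mul_le_of_le_one_left (by positivity) ?_
    have hI : ∫ θ in (0 : ℝ)..2 * Real.pi, ‖F (circleMap 0 ρ θ)‖ ≤ 2 * Real.pi := by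
      have := intervalIntegral.norm_integral_le_of_norm_le_const (a := 0) (b := 2 * Real.pi)
        (f := fun θ => ‖F (circleMap 0 ρ θ)‖) (C := 1) (fun θ _ => by
          simpa using hb _ (circleMap_mem_closedBall 0 hρ.le θ))
      rw [one_mul, sub_zero, abs_of_pos Real.two_pi_pos] at this
      exact (le_abs_self _).trans this
    calc _ ≤ (2 * Real.pi)⁻¹ * (2 * Real.pi) := by gcongr
      _ = 1 := inv_mul_cancel₀ Real.two_pi_pos.ne'
  refine ⟨p.coeff, hc, fun N w hw => ?_⟩
  have hsum : HasSum (fun n => p.coeff n * w ^ n) (F w) := by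
    have := hs.hasSum (y := w) (by
      rw [Metric.eball_coe, mem_ball_zero_iff]
      linarith)
    simpa [FormalMultilinearSeries.apply_eq_pow_smul_coeff, mul_comm] using this
  have hterm : ∀ n, ‖p.coeff n * w ^ n‖ ≤ 1 * (1 / 2 : ℝ) ^ n := by
    intro n
    rw [norm_mul, norm_pow]
    calc _ ≤ (ρ : ℝ)⁻¹ ^ n * (ρ / 2) ^ n := by gcongr; exact hc n
      _ = 1 * (1 / 2) ^ n := by rw [← mul_pow, one_mul]; congr 1; field_simp
  have := norm_sub_le_of_geometric_bound_of_hasSum (by norm_num) hterm hsum N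
  rw [norm_sub_rev]
  refine this.trans (le_of_eq ?_)
  ring

/-- the punctured unit disc has property Ω̃ at each of its points. -/
theorem statement4 (ζ : ℂ) (hζ : ζ ∈ puncturedDisc) :
    ∃ ε > (0 : ℝ), Metric.closedBall ζ ε ⊆ puncturedDisc ∧
    ∃ K₁ : Set ℂ, IsCompact K₁ ∧ K₁ ⊆ puncturedDisc ∧
    ∃ lam > (0 : ℝ), ∀ K : Set ℂ, IsCompact K → K ⊆ puncturedDisc →
      ∃ C > (0 : ℝ), ∀ r > (0 : ℝ), ∀ f : ℂ → ℂ,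
        DifferentiableOn ℂ f puncturedDisc → (∀ w ∈ K₁, ‖f w‖ ≤ 1) →
        ∃ g h : ℂ → ℂ,
          DifferentiableOn ℂ g puncturedDisc ∧ DifferentiableOn ℂ h puncturedDisc ∧
          (∀ w ∈ puncturedDisc, f w = g w + h w) ∧
          (∀ w ∈ Metric.closedBall ζ ε, ‖g w‖ ≤ C / r) ∧
          (∀ w ∈ K, ‖h w‖ ≤ r ^ lam) := by
  obtain ⟨h0, h1⟩ := hζ
  have h1' : ‖-ζ‖ < 1 := by rwa [norm_neg]
  set ρ : ℝ := ‖ζ‖ / 2 with hρdef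
  have hρ : 0 < ρ := by positivity
  have hρζ : ρ < ‖ζ‖ := by linarith
  have hρ2 : 2 ≤ ρ⁻¹ := by
    rw [le_inv_comm₀ two_pos hρ]
    linarith
  have hcont : ContinuousAt (discAut (-ζ)) ζ := (differentiableAt_discAut h1' h1).continuousAt
  have hnhds : ∀ᶠ w in nhds ζ, w ∈ puncturedDisc ∧ ‖discAut (-ζ) w‖ < ρ / 2 := by
    refine (isOpen_puncturedDisc.eventually_mem ⟨h0, h1⟩).and (hcont.norm.eventually_lt_const ?_)
    simpa [discAut] using hρ
  obtain ⟨ε, hε, hball⟩ := Metric.nhds_basis_closedBall.eventually_iff.1 hnhds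
  have hmaps : Set.MapsTo (discAut ζ) (Metric.closedBall 0 ρ) puncturedDisc := fun w hw =>
    discAut_mem_puncturedDisc h1 ((mem_closedBall_zero_iff.1 hw).trans_lt hρζ)
  have hdiff : DifferentiableOn ℂ (discAut ζ) (Metric.closedBall 0 ρ) := fun w hw =>
    (differentiableAt_discAut h1 (((mem_closedBall_zero_iff.1 hw).trans_lt hρζ).trans
      h1)).differentiableWithinAt
  refine ⟨ε, hε, fun w hw => (hball hw).1, discAut ζ '' Metric.closedBall 0 ρ,
    (isCompact_closedBall 0 ρ).image_of_continuousOn hdiff.continuousOn, hmaps.image_subset,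
    Real.logb 2 ρ⁻¹, Real.logb_pos one_lt_two (one_lt_two.trans_le hρ2),
    fun K _ hKΩ => ⟨4, by norm_num, fun r hr f hf hb => ?_⟩⟩
  obtain ⟨c, hc, hrem⟩ := exists_taylor_coeff_bound hρ (hf.comp hdiff hmaps)
    (fun w hw => hb _ (Set.mem_image_of_mem _ hw))
  have key : ∀ w ∈ Metric.closedBall ζ ε, ∀ N : ℕ,
      ‖f w - ∑ n ∈ Finset.range N, c n * discAut (-ζ) w ^ n‖ ≤ 2 * (1 / 2) ^ N := by
    intro w hw N
    have := hrem N _ (hball hw).2.le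
    rwa [Function.comp_apply, discAut_discAut_neg h1 (hball hw).1.2] at this
  obtain ⟨N, hN1, hN2⟩ : ∃ N : ℕ, (1 / 2 : ℝ) ^ N ≤ 2 / r ∧
      ∑ n ∈ Finset.range N, ρ⁻¹ ^ n ≤ r ^ Real.logb 2 ρ⁻¹ := by
    rcases le_total r 1 with hr1 | hr1
    · refine ⟨0, ?_, by simpa using Real.rpow_nonneg hr.le _⟩
      rw [pow_zero, le_div_iff₀ hr]
      linarith
    obtain ⟨N, hN1, hN2⟩ := exists_nat_pow_near hr1 one_lt_two
    refine ⟨N, ?_, ?_⟩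
    · rw [one_div, inv_pow, inv_le_iff_one_le_mul₀ (by positivity), div_mul_eq_mul_div,
        le_div_iff₀ hr, one_mul, ← pow_succ']
      exact hN2.le
    · calc ∑ n ∈ Finset.range N, ρ⁻¹ ^ n ≤ ρ⁻¹ ^ N := by
            rw [geom_sum_eq (by linarith), div_le_iff₀ (by linarith)]
            nlinarith [pow_pos (inv_pos.2 hρ) N]
        _ = ((2 : ℝ) ^ N) ^ Real.logb 2 ρ⁻¹ := by
            rw [← Real.rpow_natCast_mul two_pos.le, mul_comm,
              Real.rpow_mul_natCast two_pos.le,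
              Real.rpow_logb two_pos (by norm_num) (inv_pos.2 hρ)]
        _ ≤ r ^ Real.logb 2 ρ⁻¹ :=
            Real.rpow_le_rpow (by positivity) hN1
              (Real.logb_pos one_lt_two (one_lt_two.trans_le hρ2)).le
  have hh : DifferentiableOn ℂ (fun w => ∑ n ∈ Finset.range N, c n * discAut (-ζ) w ^ n)
      puncturedDisc := fun w hw =>
    (DifferentiableAt.fun_sum fun n _ =>
      ((differentiableAt_discAut h1' hw.2).fun_pow n).const_mul (c n)).differentiableWithinAt
  refine ⟨fun w => f w - ∑ n ∈ Finset.range N, c n * discAut (-ζ) w ^ n,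
    fun w => ∑ n ∈ Finset.range N, c n * discAut (-ζ) w ^ n, hf.sub hh, hh,
    fun w _ => (sub_add_cancel _ _).symm, fun w hw => ?_, fun w hw => ?_⟩
  · calc _ ≤ 2 * (1 / 2 : ℝ) ^ N := key w hw N
      _ ≤ 2 * (2 / r) := by gcongr
      _ = 4 / r := by ring
  · refine (norm_sum_le_of_le _ fun n _ => ?_).trans hN2
    rw [norm_mul, norm_pow]
    exact (mul_le_of_le_one_right (norm_nonneg _) (pow_le_one₀ (norm_nonneg _)
      (norm_discAut_lt_one h1' (hKΩ hw).2).le)).trans (hc n)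
end

section
/- Let Ω = {z ∈ ℂ : 0 < |z| < 1} be the punctured open unit disc. The system of sup-seminorms over compact sets on the space of holomorphic functions on Ω fails Vogt's condition Ω̃: there exists a compact set K₀ ⊆ Ω such that for every compact set K₁ ⊆ Ω and every λ > 0 there exists a compact set K ⊆ Ω with the property that for every C > 0 there exist r > 0 and a holomorphic function f : Ω → ℂ with sup_{w∈K₁}|f(w)| ≤ 1 which admits NO decomposition f = g + h with g, h holomorphic on Ω, sup_{w∈K₀}|g(w)| ≤ C/r and sup_{w∈K}|h(w)| ≤ r^λ. -/
/-- The negative Laurent coefficients of a holomorphic function on the punctured disc may be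
computed on any circle. -/
theorem circleIntegral_pow_mul_eq_of_le {h : ℂ → ℂ} (hh : DifferentiableOn ℂ h puncturedDisc)
    (n : ℕ) {b R : ℝ} (hb : 0 < b) (hbR : b ≤ R) (hR : R < 1) :
    (∮ z in C(0, R), z ^ n * h z) = ∮ z in C(0, b), z ^ n * h z := by
  have hsub : Metric.closedBall (0 : ℂ) R \ Metric.ball 0 b ⊆ puncturedDisc := by
    rintro z ⟨h1, h2⟩
    simp only [Metric.mem_closedBall, Metric.mem_ball, dist_zero_right, not_lt] at h1 h2
    exact ⟨hb.trans_le h2, h1.trans_lt hR⟩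
  have hopen : IsOpen puncturedDisc :=
    (isOpen_lt continuous_const continuous_norm).inter (isOpen_lt continuous_norm continuous_const)
  have hd : DifferentiableOn ℂ (fun z => z ^ n * h z) puncturedDisc :=
    (differentiable_pow n).differentiableOn.mul hh
  refine Complex.circleIntegral_eq_of_differentiable_on_annulus_off_countable hb hbR
    Set.countable_empty (hd.continuousOn.mono hsub) ?_
  rintro z ⟨⟨h1, h2⟩, -⟩
  refine hd.differentiableAt (hopen.mem_nhds (hsub ⟨Metric.ball_subset_closedBall h1, ?_⟩))
  exact fun h => h2 (Metric.ball_subset_closedBall h)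

theorem norm_circleIntegral_pow_mul_le {g : ℂ → ℂ} (n : ℕ) {R M : ℝ} (hR : 0 ≤ R)
    (hg : ∀ w ∈ Metric.sphere (0 : ℂ) R, ‖g w‖ ≤ M) :
    ‖∮ z in C(0, R), z ^ n * g z‖ ≤ 2 * Real.pi * (M * R ^ (n + 1)) := by
  have h := circleIntegral.norm_integral_le_of_norm_le_const (c := 0) (R := R)
    (f := fun z => z ^ n * g z) (C := R ^ n * M) hR (fun z hz => by
      have hz' : ‖z‖ = R := by simpa using hz
      rw [norm_mul, norm_pow, hz']
      exact mul_le_mul_of_nonneg_left (hg z hz) (by positivity))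
  exact h.trans_eq (by ring)

theorem sphere_subset_puncturedDisc {R : ℝ} (h0 : 0 < R) (h1 : R < 1) :
    Metric.sphere (0 : ℂ) R ⊆ puncturedDisc := by
  intro z hz
  have hz' : ‖z‖ = R := by simpa using hz
  exact ⟨by rwa [hz'], by rwa [hz']⟩

/-- If `(a / z) ^ (n + 1)` splits as `g + h` on the punctured disc, then bounds for `g` and `h` on
two circles cannot both be small. -/
theorem pow_le_of_decomposition {g h : ℂ → ℂ} (hg : DifferentiableOn ℂ g puncturedDisc)
    (hh : DifferentiableOn ℂ h puncturedDisc) {a b R M N : ℝ} (n : ℕ) (ha : 0 < a)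
    (hb : 0 < b) (hbR : b ≤ R) (hR : R < 1)
    (hfgh : ∀ w ∈ puncturedDisc, ((a : ℂ) / w) ^ (n + 1) = g w + h w)
    (hgM : ∀ w ∈ Metric.sphere (0 : ℂ) R, ‖g w‖ ≤ M)
    (hhN : ∀ w ∈ Metric.sphere (0 : ℂ) b, ‖h w‖ ≤ N) :
    a ^ (n + 1) ≤ M * R ^ (n + 1) + N * b ^ (n + 1) := by
  have hR0 : 0 < R := hb.trans_le hbR
  have hsub := sphere_subset_puncturedDisc hR0 hR
  have hcirc : ∀ {u : ℂ → ℂ}, DifferentiableOn ℂ u puncturedDisc →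
      CircleIntegrable (fun z => z ^ n * u z) 0 R := fun hu =>
    ((continuous_pow n).continuousOn.mul (hu.continuousOn.mono hsub)).circleIntegrable hR0.le
  have hleft : (∮ z in C(0, R), ((a : ℂ) ^ (n + 1)) * (z - 0)⁻¹) =
      (∮ z in C(0, R), z ^ n * g z) + ∮ z in C(0, b), z ^ n * h z := by
    rw [← circleIntegral_pow_mul_eq_of_le hh n hb hbR hR,
      ← circleIntegral.integral_add (hcirc hg) (hcirc hh)]
    refine circleIntegral.integral_congr hR0.le fun z hz => ?_
    have hz0 : z ≠ 0 := norm_pos_iff.mp (hsub hz).1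
    simp only [← mul_add, ← hfgh z (hsub hz), sub_zero, div_pow]
    field_simp
    ring
  rw [circleIntegral.integral_const_mul, circleIntegral.integral_sub_center_inv 0 hR0.ne'] at hleft
  have hnorm := congrArg norm hleft
  have hle := hnorm.trans_le ((norm_add_le _ _).trans (add_le_add
    (norm_circleIntegral_pow_mul_le n hR0.le hgM) (norm_circleIntegral_pow_mul_le n hb.le hhN)))
  have hval : ‖(a : ℂ) ^ (n + 1) * (2 * Real.pi * Complex.I)‖ = 2 * Real.pi * a ^ (n + 1) := by
    simp [abs_of_pos ha, abs_of_pos Real.pi_pos]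
    ring
  rw [hval, ← mul_add] at hle
  exact le_of_mul_le_mul_left hle Real.two_pi_pos

/-- the compact sup-seminorm system on `O(Δ∖{0})` fails Vogt's condition Ω̃. -/
theorem statement5 :
    ∃ K₀ : Set ℂ, IsCompact K₀ ∧ K₀ ⊆ puncturedDisc ∧
      ∀ K₁ : Set ℂ, IsCompact K₁ → K₁ ⊆ puncturedDisc →
      ∀ lam > (0 : ℝ),
      ∃ K : Set ℂ, IsCompact K ∧ K ⊆ puncturedDisc ∧
        ∀ C > (0 : ℝ), ∃ r > (0 : ℝ), ∃ f : ℂ → ℂ,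
          DifferentiableOn ℂ f puncturedDisc ∧ (∀ w ∈ K₁, ‖f w‖ ≤ 1) ∧
          ¬ ∃ g h : ℂ → ℂ,
              DifferentiableOn ℂ g puncturedDisc ∧ DifferentiableOn ℂ h puncturedDisc ∧
              (∀ w ∈ puncturedDisc, f w = g w + h w) ∧
              (∀ w ∈ K₀, ‖g w‖ ≤ C / r) ∧
              (∀ w ∈ K, ‖h w‖ ≤ r ^ lam) := by
  refine ⟨Metric.sphere 0 (1 / 2), isCompact_sphere _ _,
    sphere_subset_puncturedDisc (by norm_num) (by norm_num), fun K₁ hK₁ hK₁s lam hlam => ?_⟩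
  obtain ⟨a, ha, ha2, haK⟩ : ∃ a : ℝ, 0 < a ∧ a ≤ 1 / 2 ∧ ∀ w ∈ K₁, a ≤ ‖w‖ := by
    obtain ⟨a, ha, haK⟩ := hK₁.exists_forall_le' continuous_norm.continuousOn
      (a := (0 : ℝ)) (fun w hw => (hK₁s hw).1)
    exact ⟨min a (1 / 2), lt_min ha (by norm_num), min_le_right _ _,
      fun w hw => (min_le_left _ _).trans (haK w hw)⟩
  set q : ℝ := 1 / 2 / a with hq
  have hq1 : 1 ≤ q := by rwa [hq, one_le_div ha]
  have hq0 : 0 < q := by positivity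
  have hqlam : 1 ≤ q ^ lam := Real.one_le_rpow hq1 hlam.le
  set b : ℝ := a / (2 * q ^ lam) with hb
  have hb0 : 0 < b := by positivity
  have hba : b ≤ 1 / 2 := (div_le_self ha.le (by linarith)).trans ha2
  refine ⟨Metric.sphere 0 b, isCompact_sphere _ _,
    sphere_subset_puncturedDisc hb0 (by linarith), fun C hC => ?_⟩
  obtain ⟨n, hn⟩ : ∃ n : ℕ, (1 / 2 : ℝ) ^ n < 1 / (4 * C) ^ lam :=
    exists_pow_lt_of_lt_one (by positivity) (by norm_num)
  refine ⟨4 * C * q ^ (n + 1), by positivity, fun z => ((a : ℂ) / z) ^ (n + 1), ?_, ?_, ?_⟩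
  · intro z hz
    have hz0 : z ≠ 0 := norm_pos_iff.mp hz.1
    exact (((differentiableAt_const _).div differentiableAt_id hz0).pow _).differentiableWithinAt
  · intro w hw
    rw [norm_pow, norm_div, Complex.norm_real, Real.norm_of_nonneg ha.le]
    exact pow_le_one₀ (by positivity) (div_le_one_of_le₀ (haK w hw) (norm_nonneg w))
  · rintro ⟨g, h, hg, hh, hfgh, hgM, hhN⟩
    have key := pow_le_of_decomposition hg hh n ha hb0 hba (by norm_num) hfgh hgM hhN
    have hfirst : C / (4 * C * q ^ (n + 1)) * (1 / 2) ^ (n + 1) = a ^ (n + 1) / 4 := by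
      rw [show (1 / 2 : ℝ) = a * q by rw [hq]; field_simp, mul_pow]
      field_simp
    have hsecond : (4 * C * q ^ (n + 1)) ^ lam * b ^ (n + 1) =
        (4 * C) ^ lam * (1 / 2) ^ n * (a ^ (n + 1) / 2) := by
      rw [Real.mul_rpow (by positivity) (by positivity), ← Real.rpow_pow_comm hq0.le, hb, div_pow, mul_pow, div_pow, one_pow]
      field_simp
      ring
    have hsmall : (4 * C) ^ lam * (1 / 2) ^ n < 1 := by
      rwa [lt_div_iff₀' (by positivity)] at hn
    have hpos : 0 < a ^ (n + 1) := by positivity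
    rw [hfirst, hsecond] at key
    nlinarith
end

section
/- Let M = Δ×ℂ = {(z,w) ∈ ℂ² : |z| < 1}, let O(M) denote the complex vector space of holomorphic functions M → ℂ, and for S ⊆ M let U_S = {f ∈ O(M) : sup_{ζ∈S}|f(ζ)| ≤ 1}. Then for every compact set K ⊆ M there exist a compact set K' ⊆ M with K ⊆ K' and a constant C > 0 such that for every n ∈ ℕ there is a linear subspace L_n ⊆ O(M) with dim L_n ≤ n and U_{K'} ⊆ (C·e^{−√(n/3)})·U_K + L_n. In other words, the n-th Kolmogorov diameters satisfy d_n(U_{K'};U_K) ≤ C·e^{−√(n/3)}, so the sequence (e^{√(n/3)})_n belongs to the diametral dimension of O(Δ×ℂ). -/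
open Finset in
/-- Taylor remainder estimate for a bounded holomorphic function of one variable. -/
theorem norm_sub_taylor_sum_le {h : ℂ → ℂ} {ρ s M q : ℝ} (hs : 0 < s) (hsρ : s < ρ)
    (hh : DifferentiableOn ℂ h (Metric.ball 0 ρ)) (hM : ∀ z ∈ Metric.closedBall (0 : ℂ) s, ‖h z‖ ≤ M)
    (hq : q < 1) {z : ℂ} (hz : ‖z‖ ≤ q * s) (a : ℕ) :
    ‖h z - ∑ i ∈ range a, ((i.factorial : ℂ)⁻¹ * iteratedDeriv i h 0) * z ^ i‖
      ≤ M * q ^ a / (1 - q) := by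
  have hq0 : 0 ≤ q := nonneg_of_mul_nonneg_left ((norm_nonneg z).trans hz) hs
  have hzρ : z ∈ Metric.ball (0 : ℂ) ρ := by
    rw [mem_ball_zero_iff]; nlinarith
  have hcl : DiffContOnCl ℂ h (Metric.ball 0 s) :=
    (hh.mono (Metric.closedBall_subset_ball hsρ)).diffContOnCl_ball subset_rfl
  have hbound (i : ℕ) : ‖((i.factorial : ℂ)⁻¹ * iteratedDeriv i h 0) * z ^ i‖ ≤ M * q ^ i := by
    have h1 := Complex.norm_iteratedDeriv_le_of_forall_mem_sphere_norm_le i hs hcl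
      (fun z hz => hM z (Metric.sphere_subset_closedBall hz))
    have hM0 : 0 ≤ M := (norm_nonneg _).trans (hM 0 (Metric.mem_closedBall_self hs.le))
    rw [norm_mul, norm_mul, norm_inv, Complex.norm_natCast, norm_pow]
    have hf : (0 : ℝ) < i.factorial := by positivity
    calc (i.factorial : ℝ)⁻¹ * ‖iteratedDeriv i h 0‖ * ‖z‖ ^ i
        ≤ (i.factorial : ℝ)⁻¹ * (i.factorial * M / s ^ i) * (q * s) ^ i := by gcongr
      _ = M * q ^ i := by rw [mul_pow]; field_simp
  have hsum : HasSum (fun i : ℕ => ((i.factorial : ℂ)⁻¹ * iteratedDeriv i h 0) * z ^ i) (h z) := by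
    have h1 := Complex.hasSum_taylorSeries_on_ball hh hzρ
    simp only [sub_zero, smul_eq_mul] at h1
    simpa only [mul_assoc, mul_comm (z ^ _)] using h1
  have htail := (hasSum_nat_add_iff' a).2 hsum
  have hgeo : HasSum (fun i : ℕ => M * q ^ a * q ^ i) (M * q ^ a * (1 - q)⁻¹) :=
    (hasSum_geometric_of_lt_one hq0 hq).mul_left _
  rw [div_eq_mul_inv]
  refine htail.norm_le_of_bounded hgeo fun i => ?_
  rw [mul_assoc M, ← pow_add, add_comm a i]
  exact hbound _

theorem norm_taylorCoeff_le {h : ℂ → ℂ} {ρ s M : ℝ} (hs : 0 < s) (hsρ : s < ρ)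
    (hh : DifferentiableOn ℂ h (Metric.ball 0 ρ)) (hM : ∀ z ∈ Metric.closedBall (0 : ℂ) s, ‖h z‖ ≤ M)
    (i : ℕ) : ‖(i.factorial : ℂ)⁻¹ * iteratedDeriv i h 0‖ ≤ M / s ^ i := by
  have hcl : DiffContOnCl ℂ h (Metric.ball 0 s) :=
    (hh.mono (Metric.closedBall_subset_ball hsρ)).diffContOnCl_ball subset_rfl
  have h1 := Complex.norm_iteratedDeriv_le_of_forall_mem_sphere_norm_le i hs hcl
    (fun z hz => hM z (Metric.sphere_subset_closedBall hz))
  rw [norm_mul, norm_inv, Complex.norm_natCast]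
  calc (i.factorial : ℝ)⁻¹ * ‖iteratedDeriv i h 0‖
      ≤ (i.factorial : ℝ)⁻¹ * (i.factorial * M / s ^ i) := by gcongr
    _ = M / s ^ i := by
      have hf : (0 : ℝ) < i.factorial := by positivity
      field_simp

theorem differentiableOn_slice_fst {f : ℂ × ℂ → ℂ} (hf : DifferentiableOn ℂ f discTimesPlane)
    (w : ℂ) : DifferentiableOn ℂ (fun z => f (z, w)) (Metric.ball 0 1) :=
  hf.comp (f := fun z : ℂ => (z, w)) (by fun_prop) fun z hz => by
    simpa [discTimesPlane] using hz

theorem differentiable_slice_snd {f : ℂ × ℂ → ℂ} (hf : DifferentiableOn ℂ f discTimesPlane)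
    {z : ℂ} (hz : ‖z‖ < 1) : Differentiable ℂ (fun w => f (z, w)) := by
  rw [← differentiableOn_univ]
  exact hf.comp (f := fun w : ℂ => (z, w)) (by fun_prop) fun w _ => hz

open Finset in
/-- The Taylor coefficients in the first variable are entire functions of the second. -/
theorem differentiable_taylorCoeff_slice {f : ℂ × ℂ → ℂ}
    (hf : DifferentiableOn ℂ f discTimesPlane) (i : ℕ) :
    Differentiable ℂ
      (fun w => (i.factorial : ℂ)⁻¹ * iteratedDeriv i (fun z => f (z, w)) 0) := by
  induction i using Nat.strong_induction_on with
  | _ i ih =>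
  set c : ℕ → ℂ → ℂ :=
    fun i w => (i.factorial : ℂ)⁻¹ * iteratedDeriv i (fun z => f (z, w)) 0 with hc
  set x : ℕ → ℂ := fun n => (((1 / (n + 2) * (1 / 2) : ℝ)) : ℂ) with hx
  have hx0 (n : ℕ) : x n ≠ 0 := by
    simp only [hx, ne_eq, Complex.ofReal_eq_zero]; positivity
  have hxn (n : ℕ) : ‖x n‖ = 1 / (n + 2) * (1 / 2) := by
    simp only [hx, Complex.norm_real]; exact abs_of_pos (by positivity)
  have hq1 (n : ℕ) : (1 / (n + 2) : ℝ) < 1 := by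
    rw [div_lt_one (by positivity)]; linarith [(Nat.cast_nonneg n : (0 : ℝ) ≤ n)]
  have hx1 (n : ℕ) : ‖x n‖ < 1 := by rw [hxn]; linarith [hq1 n]
  set F : ℕ → ℂ → ℂ := fun n w => (f (x n, w) - ∑ j ∈ range i, c j w * x n ^ j) / x n ^ i with hF
  have hFd (n : ℕ) : DifferentiableOn ℂ (F n) Set.univ := by
    refine Differentiable.differentiableOn ?_
    refine Differentiable.div_const (Differentiable.sub (differentiable_slice_snd hf (hx1 n)) ?_) _
    exact Differentiable.fun_sum fun j hj => (ih j (mem_range.1 hj)).mul_const _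
  have hlim : TendstoLocallyUniformlyOn F (c i) Filter.atTop Set.univ := by
    rw [tendstoLocallyUniformlyOn_iff_forall_isCompact isOpen_univ]
    intro T _ hT
    obtain ⟨M, hM⟩ := (((isCompact_closedBall (0 : ℂ) (1 / 2)).prod hT).exists_bound_of_continuousOn
      (hf.continuousOn.mono fun p hp => by
        have := mem_closedBall_zero_iff.1 hp.1
        simp only [discTimesPlane, Set.mem_ofPred_eq]; linarith))
    have hbd (n : ℕ) {w : ℂ} (hw : w ∈ T) : dist (c i w) (F n w) ≤ M * 2 ^ i * (1 / (n + 1)) := by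
      have h1 := norm_sub_taylor_sum_le (s := 1 / 2) (M := M) (by norm_num) (by norm_num)
        (differentiableOn_slice_fst hf w) (fun z hz => hM (z, w) ⟨hz, hw⟩) (hq1 n) (hxn n).le (i + 1)
      rw [sum_range_succ] at h1
      have h2 : F n w - c i w = (f (x n, w) - (∑ j ∈ range i, c j w * x n ^ j + c i w * x n ^ i))
          / x n ^ i := by
        have := hx0 n
        simp only [hF]; field_simp; ring
      rw [dist_comm, dist_eq_norm, h2, norm_div, norm_pow, hxn]
      rw [div_le_iff₀ (by positivity)]
      refine h1.trans (le_of_eq ?_)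
      have e1 : (1 - 1 / ((n : ℝ) + 2)) = (n + 1) / (n + 2) := by field_simp; ring
      rw [e1]
      have : (0 : ℝ) < n + 1 := by positivity
      have : (0 : ℝ) < n + 2 := by positivity
      rw [mul_pow, pow_succ, one_div_pow (2 : ℝ)]
      field_simp
    rw [Metric.tendstoUniformlyOn_iff]
    intro ε hε
    have ht : Filter.Tendsto (fun n : ℕ => M * 2 ^ i * (1 / ((n : ℝ) + 1))) Filter.atTop
        (nhds (M * 2 ^ i * 0)) := tendsto_one_div_add_atTop_nhds_zero_nat.const_mul _
    rw [mul_zero] at ht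
    filter_upwards [ht.eventually (gt_mem_nhds hε)] with n hn w hw
    exact (hbd n hw).trans_lt hn
  rw [← differentiableOn_univ]
  exact hlim.differentiableOn (Filter.Eventually.of_forall hFd) isOpen_univ

open Finset in
/-- Approximation by polynomials of bidegree below `(a, b)`. -/
theorem norm_sub_bidegree_taylor_le {f : ℂ × ℂ → ℂ} (hf : DifferentiableOn ℂ f discTimesPlane)
    {s S p q : ℝ} (hs : 0 < s) (hs1 : s < 1) (hS : 0 < S)
    (hM : ∀ ζ ∈ Metric.closedBall (0 : ℂ) s ×ˢ Metric.closedBall (0 : ℂ) S, ‖f ζ‖ ≤ 1)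
    (hp0 : 0 ≤ p) (hp : p < 1) (hq0 : 0 ≤ q) (hq : q < 1) (a b : ℕ) :
    ∃ d : ℕ → ℕ → ℂ, ∀ z w : ℂ, ‖z‖ ≤ q * s → ‖w‖ ≤ p * S →
      ‖f (z, w) - ∑ i ∈ range a, ∑ j ∈ range b, d i j * (z ^ i * w ^ j)‖
        ≤ q ^ a / (1 - q) + p ^ b / (1 - p) / (1 - q) := by
  set c : ℕ → ℂ → ℂ :=
    fun i w => (i.factorial : ℂ)⁻¹ * iteratedDeriv i (fun z => f (z, w)) 0 with hc
  refine ⟨fun i j => (j.factorial : ℂ)⁻¹ * iteratedDeriv j (c i) 0, fun z w hz hw => ?_⟩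
  have hcb (i : ℕ) : ∀ w ∈ Metric.closedBall (0 : ℂ) S, ‖c i w‖ ≤ 1 / s ^ i := fun w hw =>
    norm_taylorCoeff_le hs hs1 (differentiableOn_slice_fst hf w) (fun z hz => hM (z, w) ⟨hz, hw⟩) i
  have hwS : w ∈ Metric.closedBall (0 : ℂ) S := by
    rw [mem_closedBall_zero_iff]; nlinarith
  have h1 := norm_sub_taylor_sum_le hs hs1 (differentiableOn_slice_fst hf w)
    (fun z hz => hM (z, w) ⟨hz, hwS⟩) hq hz a
  have h2 (i : ℕ) := norm_sub_taylor_sum_le hS (lt_add_one S)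
    (differentiable_taylorCoeff_slice hf i).differentiableOn (hcb i) hp hw b
  have hp' : 0 < 1 - p := by linarith
  have h3 : ‖∑ i ∈ range a, (c i w - ∑ j ∈ range b,
      ((j.factorial : ℂ)⁻¹ * iteratedDeriv j (c i) 0) * w ^ j) * z ^ i‖
      ≤ p ^ b / (1 - p) / (1 - q) := by
    calc _ ≤ ∑ i ∈ range a, p ^ b / (1 - p) * q ^ i := by
          refine norm_sum_le_of_le _ fun i _ => ?_
          rw [norm_mul, norm_pow]
          calc _ ≤ (1 / s ^ i * p ^ b / (1 - p)) * (q * s) ^ i := by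
                gcongr
                exact h2 i
            _ = p ^ b / (1 - p) * q ^ i := by rw [mul_pow]; field_simp
      _ = p ^ b / (1 - p) * ∑ i ∈ range a, q ^ i := by rw [mul_sum]
      _ ≤ p ^ b / (1 - p) * (1 - q)⁻¹ := by
          gcongr
          rw [← tsum_geometric_of_lt_one hq0 hq]
          exact (summable_geometric_of_lt_one hq0 hq).sum_le_tsum _ fun i _ => pow_nonneg hq0 i
      _ = _ := (div_eq_mul_inv _ _).symm
  rw [one_mul] at h1
  refine le_trans (le_of_eq ?_) ((norm_add_le _ _).trans (add_le_add h1 h3))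
  congr 1
  have h4 (i : ℕ) : ∑ j ∈ range b, (j.factorial : ℂ)⁻¹ * iteratedDeriv j (c i) 0 * (z ^ i * w ^ j)
      = (∑ j ∈ range b, (j.factorial : ℂ)⁻¹ * iteratedDeriv j (c i) 0 * w ^ j) * z ^ i := by
    rw [sum_mul]
    exact sum_congr rfl fun j _ => by ring
  rw [sum_congr rfl fun i _ => h4 i]
  simp only [sub_mul, sum_sub_distrib, hc]
  ring

theorem exists_bidisc_of_isCompact {K : Set (ℂ × ℂ)} (hK : IsCompact K)
    (hKs : K ⊆ discTimesPlane) :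
    ∃ r R : ℝ, 0 < r ∧ r < 1 ∧ 0 < R ∧ ∀ ζ ∈ K, ‖ζ.1‖ ≤ r ∧ ‖ζ.2‖ ≤ R := by
  rcases K.eq_empty_or_nonempty with rfl | hne
  · exact ⟨1 / 2, 1, by norm_num, by norm_num, one_pos, by simp⟩
  obtain ⟨x, hx, hxm⟩ := hK.exists_isMaxOn hne (f := fun ζ : ℂ × ℂ => ‖ζ.1‖) (by fun_prop)
  obtain ⟨y, -, hym⟩ := hK.exists_isMaxOn hne (f := fun ζ : ℂ × ℂ => ‖ζ.2‖) (by fun_prop)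
  have hx1 : ‖x.1‖ < 1 := hKs hx
  refine ⟨max ‖x.1‖ (1 / 2), ‖y.2‖ + 1, by positivity, max_lt hx1 (by norm_num), by positivity,
    fun ζ hζ => ⟨(hxm hζ).trans (le_max_left _ _), ?_⟩⟩
  have : ‖ζ.2‖ ≤ ‖y.2‖ := hym hζ
  linarith

/-- Polynomials in two variables of bidegree below `(a, b)`, as functions. -/
def bidegreeLT (a b : ℕ) : Submodule ℂ ((ℂ × ℂ) → ℂ) :=
  Submodule.span ℂ (Set.range fun (ij : Fin a × Fin b) (ζ : ℂ × ℂ) =>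
    ζ.1 ^ (ij.1 : ℕ) * ζ.2 ^ (ij.2 : ℕ))

theorem differentiable_of_mem_bidegreeLT {a b : ℕ} {g : ℂ × ℂ → ℂ} (hg : g ∈ bidegreeLT a b) :
    Differentiable ℂ g := by
  induction hg using Submodule.span_induction with
  | mem g hg => obtain ⟨ij, rfl⟩ := hg; fun_prop
  | zero => exact differentiable_const 0
  | add _ _ _ _ h₁ h₂ => exact h₁.add h₂
  | smul t _ _ h => exact h.const_smul t

theorem rank_bidegreeLT_le (a b : ℕ) :
    Module.rank ℂ (bidegreeLT a b) ≤ ((a * b : ℕ) : Cardinal) := by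
  refine (rank_span_le _).trans (Cardinal.mk_range_le.trans ?_)
  simp

open Finset in
theorem sum_monomial_mem_bidegreeLT (a b : ℕ) (d : ℕ → ℕ → ℂ) :
    (fun ζ : ℂ × ℂ => ∑ i ∈ range a, ∑ j ∈ range b, d i j * (ζ.1 ^ i * ζ.2 ^ j))
      ∈ bidegreeLT a b := by
  have : (fun ζ : ℂ × ℂ => ∑ i ∈ range a, ∑ j ∈ range b, d i j * (ζ.1 ^ i * ζ.2 ^ j))
      = ∑ i ∈ range a, ∑ j ∈ range b, d i j • fun ζ : ℂ × ℂ => ζ.1 ^ i * ζ.2 ^ j := by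
    ext ζ; simp
  rw [this]
  refine Submodule.sum_mem _ fun i hi => Submodule.sum_mem _ fun j hj =>
    Submodule.smul_mem _ _ (Submodule.subset_span ?_)
  exact ⟨(⟨i, mem_range.1 hi⟩, ⟨j, mem_range.1 hj⟩), rfl⟩

/-- Kolmogorov diameter bound `d_n(U_{K'};U_K) ≤ C·e^{−√(n/3)}` for `O(Δ×ℂ)`,
so `(e^{√(n/3)})_n` belongs to the diametral dimension of `O(Δ×ℂ)`. -/
theorem statement7 :
    ∀ K : Set (ℂ × ℂ), IsCompact K → K ⊆ discTimesPlane →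
    ∃ K' : Set (ℂ × ℂ), IsCompact K' ∧ K ⊆ K' ∧ K' ⊆ discTimesPlane ∧
    ∃ C > (0 : ℝ), ∀ n : ℕ,
      ∃ L : Submodule ℂ ((ℂ × ℂ) → ℂ),
        (∀ g ∈ L, DifferentiableOn ℂ g discTimesPlane) ∧
        Module.rank ℂ L ≤ (n : Cardinal) ∧
        ∀ f : ℂ × ℂ → ℂ, DifferentiableOn ℂ f discTimesPlane → (∀ ζ ∈ K', ‖f ζ‖ ≤ 1) →
          ∃ u : ℂ × ℂ → ℂ, ∃ l ∈ L,
            DifferentiableOn ℂ u discTimesPlane ∧ (∀ ζ ∈ K, ‖u ζ‖ ≤ 1) ∧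
            f = ((C * Real.exp (-Real.sqrt ((n : ℝ) / 3)) : ℝ) : ℂ) • u + l := by
  intro K hK hKs
  obtain ⟨r, R, hr0, hr1, hR, hKr⟩ := exists_bidisc_of_isCompact hK hKs
  obtain ⟨s, hrs, hs1⟩ := exists_between hr1
  have hs : 0 < s := hr0.trans hrs
  have hq0 : 0 ≤ r / s := by positivity
  have hq1 : r / s < 1 := (div_lt_one hs).2 hrs
  set q := r / s with hq
  obtain ⟨k, hk⟩ := exists_pow_lt_of_lt_one (Real.exp_pos (-1)) hq1
  obtain ⟨A, hA0, hA⟩ : ∃ A : ℕ, 0 < A ∧ q ^ A ≤ Real.exp (-1) :=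
    ⟨k + 1, k.succ_pos, (pow_le_pow_of_le_one hq0 hq1.le k.le_succ).trans hk.le⟩
  set p := Real.exp (-(A : ℝ)) with hp
  have hp0 : 0 < p := Real.exp_pos _
  have hp1 : p < 1 := Real.exp_zero ▸ Real.exp_lt_exp.2 (by simpa using hA0)
  have hqs : q * s = r := div_mul_cancel₀ _ hs.ne'
  have hpS : p * (R / p) = R := mul_div_cancel₀ _ hp0.ne'
  have hq' : 0 < 1 - q := by linarith
  have hp' : 0 < 1 - p := by linarith
  have hRS : R ≤ R / p := le_div_self hR.le hp0 hp1.le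
  refine ⟨Metric.closedBall 0 s ×ˢ Metric.closedBall 0 (R / p),
    (isCompact_closedBall _ _).prod (isCompact_closedBall _ _), ?_, ?_,
    Real.exp 1 / (1 - q) + Real.exp A / (1 - p) / (1 - q), by positivity, fun n => ?_⟩
  · intro ζ hζ
    simp only [Set.mem_prod, mem_closedBall_zero_iff]
    exact ⟨(hKr ζ hζ).1.trans hrs.le, (hKr ζ hζ).2.trans hRS⟩
  · intro ζ hζ
    exact (mem_closedBall_zero_iff.1 hζ.1).trans_lt hs1
  set m := Nat.sqrt n with hm
  have hcard : A * m * (m / A) ≤ n := calc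
    A * m * (m / A) = m * (A * (m / A)) := by ring
    _ ≤ m * m := Nat.mul_le_mul_left _ (Nat.mul_div_le m A)
    _ ≤ n := Nat.sqrt_le n
  have hsq : √((n : ℝ) / 3) ≤ m + 1 := by
    rw [Real.sqrt_le_left (by positivity)]
    have : (n : ℝ) ≤ (m + 1) ^ 2 := by exact_mod_cast (Nat.lt_succ_sqrt' n).le
    linarith [(Nat.cast_nonneg n : (0 : ℝ) ≤ n)]
  have hqa : q ^ (A * m) ≤ Real.exp 1 * Real.exp (-√((n : ℝ) / 3)) := calc
    q ^ (A * m) = (q ^ A) ^ m := pow_mul _ _ _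
    _ ≤ Real.exp (-1) ^ m := by gcongr
    _ = Real.exp (-m) := by rw [← Real.exp_nat_mul]; simp
    _ ≤ _ := by rw [← Real.exp_add]; gcongr; linarith
  have hpb : p ^ (m / A) ≤ Real.exp A * Real.exp (-√((n : ℝ) / 3)) := by
    have h1 : (m + 1 : ℝ) ≤ A * (m / A : ℕ) + A := by
      exact_mod_cast (Nat.lt_mul_div_succ m hA0)
    rw [hp, ← Real.exp_nat_mul, ← Real.exp_add]
    gcongr
    linarith
  set E := Real.exp (-√((n : ℝ) / 3)) with hE
  have hE0 : 0 < E := Real.exp_pos _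
  set C := Real.exp 1 / (1 - q) + Real.exp A / (1 - p) / (1 - q) with hC
  have hC0 : 0 < C := by positivity
  refine ⟨bidegreeLT (A * m) (m / A),
    fun g hg => (differentiable_of_mem_bidegreeLT hg).differentiableOn,
    (rank_bidegreeLT_le _ _).trans (by exact_mod_cast hcard), fun f hf hfK => ?_⟩
  obtain ⟨d, hd⟩ := norm_sub_bidegree_taylor_le hf hs hs1 (by positivity : 0 < R / p) hfK hp0.le hp1
    hq0 hq1 (A * m) (m / A)
  have hl := sum_monomial_mem_bidegreeLT (A * m) (m / A) d
  set l : ℂ × ℂ → ℂ := fun ζ => ∑ i ∈ Finset.range (A * m), ∑ j ∈ Finset.range (m / A),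
    d i j * (ζ.1 ^ i * ζ.2 ^ j) with hldef
  have hCE : ((C * E : ℝ) : ℂ) ≠ 0 := by exact_mod_cast (by positivity : C * E ≠ 0)
  refine ⟨((C * E : ℝ) : ℂ)⁻¹ • (f - l), l, hl,
    (hf.sub (differentiable_of_mem_bidegreeLT hl).differentiableOn).const_smul _,
    fun ζ hζ => ?_, by rw [smul_inv_smul₀ hCE, sub_add_cancel]⟩
  have h1 := hd ζ.1 ζ.2 (by rw [hqs]; exact (hKr ζ hζ).1) (by rw [hpS]; exact (hKr ζ hζ).2)
  have h2 : ‖f ζ - l ζ‖ ≤ C * E := by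
    refine h1.trans ?_
    calc _ ≤ Real.exp 1 * E / (1 - q) + Real.exp A * E / (1 - p) / (1 - q) := by gcongr
      _ = C * E := by rw [hC]; ring
  rw [Pi.smul_apply, Pi.sub_apply, norm_smul, norm_inv, Complex.norm_real,
    Real.norm_of_nonneg (by positivity)]
  exact inv_mul_le_one_of_le₀ h2 (by positivity)
end

section
/- Let X be a vector space over ℂ and let (p_k)_{k≥0} be seminorms on X with unit balls U_k = {x ∈ X : p_k(x) ≤ 1}. Suppose that for each k ≥ 0 there are a finite set M_k ⊆ X and a real number ε_k with 0 < ε_k ≤ 2^{−k} such that U_{k+1} ⊆ ε_k·U_k + M_k (i.e. every x with p_{k+1}(x) ≤ 1 can be written x = ε_k·y + m with p_k(y) ≤ 1, m ∈ M_k). Let Λ = ⋃_{k≥0} M_k, and let g : X → ℂ be a linear functional such that |g(y)| ≤ L for all y ∈ Λ and |g(y)| ≤ a for all y ∈ U₀. Then for every n ≥ 1 and every x ∈ X with p_n(x) ≤ 1 one has |g(x)| ≤ 2·L + (∏_{k=0}^{n−1} ε_k)·a. -/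
/-- the iteration step in the proof of (3) ⇒ (1) of Theorem 2.2. -/
theorem statement8 {X : Type*} [AddCommGroup X] [Module ℂ X]
    (p : ℕ → Seminorm ℂ X) (M : ℕ → Finset X) (ε : ℕ → ℝ)
    (hεpos : ∀ k, 0 < ε k) (hεle : ∀ k, ε k ≤ 1 / 2 ^ k)
    (hdec : ∀ k, ∀ x : X, p (k + 1) x ≤ 1 →
      ∃ y m, p k y ≤ 1 ∧ m ∈ M k ∧ x = ((ε k : ℝ) : ℂ) • y + m)
    (g : X →ₗ[ℂ] ℂ) (L a : ℝ)
    (hgΛ : ∀ k, ∀ y ∈ M k, ‖g y‖ ≤ L)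
    (hg0 : ∀ y : X, p 0 y ≤ 1 → ‖g y‖ ≤ a) :
    ∀ n : ℕ, 1 ≤ n → ∀ x : X, p n x ≤ 1 →
      ‖g x‖ ≤ 2 * L + (∏ k ∈ Finset.range n, ε k) * a := by
  have hL : 0 ≤ L := by
    obtain ⟨y, m, -, hm, -⟩ := hdec 0 0 (by simp)
    exact (norm_nonneg _).trans (hgΛ 0 m hm)
  have hstep : ∀ k, ∀ B : ℝ, (∀ y, p k y ≤ 1 → ‖g y‖ ≤ B) →
      ∀ x, p (k + 1) x ≤ 1 → ‖g x‖ ≤ ε k * B + L := by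
    intro k B hB x hx
    obtain ⟨y, m, hy, hm, rfl⟩ := hdec k x hx
    calc ‖g (((ε k : ℝ) : ℂ) • y + m)‖ = ‖((ε k : ℝ) : ℂ) * g y + g m‖ := by
          rw [map_add, map_smul, smul_eq_mul]
      _ ≤ ‖((ε k : ℝ) : ℂ) * g y‖ + ‖g m‖ := norm_add_le _ _
      _ = ε k * ‖g y‖ + ‖g m‖ := by
          rw [norm_mul, Complex.norm_real, Real.norm_of_nonneg (hεpos k).le]
      _ ≤ ε k * B + L :=
          add_le_add (mul_le_mul_of_nonneg_left (hB y hy) (hεpos k).le) (hgΛ k m hm)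
  intro n hn
  induction n, hn using Nat.le_induction with
  | base =>
    intro x hx
    have h := hstep 0 a hg0 x hx
    rw [Finset.prod_range_one]
    linarith
  | succ n hn ih =>
    intro x hx
    have h := hstep n _ ih x hx
    have hε : ε n ≤ 1 / 2 := by
      refine (hεle n).trans (one_div_le_one_div_of_le two_pos ?_)
      exact le_self_pow₀ one_le_two (by omega)
    have hεL : ε n * L ≤ 1 / 2 * L := mul_le_mul_of_nonneg_right hε hL
    rw [Finset.prod_range_succ]
    linarith
end

section
/- Let Ω ⊆ ℂ^d be open, let K ⊆ Ω be a nonempty compact set, let z ∈ Ω, and let C > 0. Suppose that for every holomorphic function f : Ω → ℂ one has |f(z)| ≤ C·sup_{w∈K}|f(w)|. Then in fact for every holomorphic f : Ω → ℂ one has |f(z)| ≤ sup_{w∈K}|f(w)|. -/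
/-- A bound `a ^ n ≤ C * b ^ n` on all powers forces `a ≤ b`. -/
lemma le_of_forall_pow_le_const_mul_pow {a b C : ℝ} (hb : 0 ≤ b)
    (h : ∀ n : ℕ, a ^ n ≤ C * b ^ n) : a ≤ b := by
  by_contra! hab
  rcases hb.eq_or_lt with rfl | hb
  · have := h 1
    simp only [pow_one, mul_zero] at this
    linarith
  · obtain ⟨n, hn⟩ := pow_unbounded_of_one_lt C ((one_lt_div hb).2 hab)
    rw [div_pow, lt_div_iff₀ (pow_pos hb n)] at hn
    exact absurd (h n) hn.not_ge

/-- On a set where a nonnegative `g` is bounded above, it is at most its real-valued bounded supremum. -/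
lemma le_biSup_of_nonneg {α : Type*} {g : α → ℝ} {K : Set α} (hg : ∀ w, 0 ≤ g w)
    (hb : BddAbove (g '' K)) {w : α} (hw : w ∈ K) : g w ≤ ⨆ v ∈ K, g v := by
  obtain ⟨B, hB⟩ := hb
  have hB' : ∀ v ∈ K, g v ≤ B := fun v hv => hB ⟨v, hv, rfl⟩
  have hbdd : BddAbove (Set.range fun v => ⨆ _ : v ∈ K, g v) := by
    refine ⟨B, ?_⟩
    rintro _ ⟨v, rfl⟩
    exact Real.iSup_le (hB' v) ((hg w).trans (hB' w hw))
  simpa [hw] using le_ciSup hbdd w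

/-- if `|f(z)| ≤ C·sup_K |f|` for all holomorphic `f` on `Ω`, then in fact
`|f(z)| ≤ sup_K |f|` for all such `f`. -/
theorem statement10 (d : ℕ) (Ω : Set (EuclideanSpace ℂ (Fin d))) (hΩ : IsOpen Ω)
    (K : Set (EuclideanSpace ℂ (Fin d))) (hK : IsCompact K) (hKne : K.Nonempty)
    (hKΩ : K ⊆ Ω) (z : EuclideanSpace ℂ (Fin d)) (hz : z ∈ Ω) (C : ℝ) (hC : 0 < C)
    (hyp : ∀ f : EuclideanSpace ℂ (Fin d) → ℂ, DifferentiableOn ℂ f Ω →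
      ‖f z‖ ≤ C * ⨆ w ∈ K, ‖f w‖) :
    ∀ f : EuclideanSpace ℂ (Fin d) → ℂ, DifferentiableOn ℂ f Ω →
      ‖f z‖ ≤ ⨆ w ∈ K, ‖f w‖ := by
  intro f hf
  have hbdd : BddAbove ((fun w => ‖f w‖) '' K) :=
    hK.bddAbove_image (hf.continuousOn.mono hKΩ).norm
  have hM : 0 ≤ ⨆ w ∈ K, ‖f w‖ :=
    Real.iSup_nonneg fun w => Real.iSup_nonneg fun _ => norm_nonneg _
  refine le_of_forall_pow_le_const_mul_pow (C := C) hM fun n => ?_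
  calc ‖f z‖ ^ n = ‖(f ^ n) z‖ := by simp
    _ ≤ C * ⨆ w ∈ K, ‖(f ^ n) w‖ := hyp _ (hf.pow n)
    _ ≤ C * (⨆ w ∈ K, ‖f w‖) ^ n := by
      gcongr
      refine Real.iSup_le (fun w => Real.iSup_le (fun hw => ?_) (pow_nonneg hM n))
        (pow_nonneg hM n)
      rw [Pi.pow_apply, norm_pow]
      gcongr
      exact le_biSup_of_nonneg (fun v => norm_nonneg (f v)) hbdd hw
end
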